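/- Let B be a base and S ⊆ V such that B △ S is also a base, and let C and C' be the fundamental cocircuit matrices with respect to B and B △ S, respectively. Then for every X ⊆ V, C[X] is nonsingular if and only if C'[X △ S] is nonsingular. -/

import Mathlib

open Matrix

/-- A matrix whose row and column index types may differ is *nonsingular* if there is an
index bijection under which its determinant is nonzero.  (This forces the two index sets
to have the same cardinality; the empty matrix is nonsingular by convention.) -/
def Matrix.Nonsing {K : Type*} [CommRing K] {α β : Type*} [Fintype α] [Fintype β]
    [DecidableEq α] (M : Matrix α β K) : Prop :=
  ∃ e : α ≃ β, (M.submatrix id e).det ≠ 0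

/-- The inclusion map between the coercions of two finsets, one contained in the other. -/
def Finset.incl {V : Type*} {P Q : Finset V} (h : P ⊆ Q) (x : ↥P) : ↥Q := ⟨x.1, h x.2⟩

/-- `B` is a base of the column matroid of `A`: `|B| = |U|` and `A[U,B]` is nonsingular. -/
def Matrix.IsBase {K U V : Type*} [CommRing K] [Fintype U] [Fintype V] [DecidableEq U]
    (A : Matrix U V K) (B : Finset V) : Prop :=
  Matrix.Nonsing (A.submatrix id (fun b : ↥B => (b : V)))

/-- `C` is the fundamental cocircuit matrix of `A` with respect to the base `B`, i.e.
`C = A[U,B]⁻¹ · A[U, V∖B]`, expressed as `A[U,B] * C = A[U, V∖B]`. -/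
def Matrix.IsCocircuitMatrix {K U V : Type*} [CommRing K] [Fintype U] [Fintype V]
    [DecidableEq V] (A : Matrix U V K) (B : Finset V) (C : Matrix ↥B ↥(Bᶜ) K) : Prop :=
  A.submatrix id (fun b : ↥B => (b : V)) * C = A.submatrix id (fun v : ↥(Bᶜ) => (v : V))

/-- The submatrix `C[X] = C[X ∩ B, X ∖ B]` of a matrix `C` with row set `B` and column
set `V ∖ B`. -/
def csub {K V : Type*} [CommRing K] [Fintype V] [DecidableEq V] (B : Finset V)
    (C : Matrix ↥B ↥(Bᶜ) K) (X : Finset V) : Matrix ↥(X ∩ B) ↥(X \ B) K :=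
  C.submatrix (Finset.incl Finset.inter_subset_right)
    (Finset.incl (by intro a ha; exact Finset.mem_compl.mpr (Finset.mem_sdiff.mp ha).2))

namespace Matrix

variable {K : Type*} [Field K] {α β γ δ : Type*} [Fintype α] [Fintype β] [Fintype γ] [Fintype δ]
  [DecidableEq α] [DecidableEq β] [DecidableEq γ] [DecidableEq δ]

/-- A rectangular matrix over a field is nonsingular iff it has a two-sided inverse. -/
theorem nonsing_iff_exists_inverse (M : Matrix α β K) :
    M.Nonsing ↔ ∃ N : Matrix β α K, M * N = 1 ∧ N * M = 1 := by
  constructor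
  · rintro ⟨e, he⟩
    have hu : IsUnit (M.submatrix id e).det := isUnit_iff_ne_zero.mpr he
    have hM : M = (M.submatrix id e).submatrix id e.symm := by ext; simp
    refine ⟨(M.submatrix id e)⁻¹.submatrix e.symm id, ?_, ?_⟩
    · conv_lhs => enter [1]; rw [hM]
      rw [submatrix_mul_equiv, mul_nonsing_inv _ hu, submatrix_id_id]
    · conv_lhs => enter [2]; rw [hM]
      rw [← submatrix_mul _ _ _ id _ Function.bijective_id, nonsing_inv_mul _ hu,
        submatrix_one_equiv]
  · rintro ⟨N, hMN, hNM⟩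
    have hcard : Fintype.card α = Fintype.card β := by
      simpa using (toLin'OfInv hNM hMN).finrank_eq.symm
    refine ⟨Fintype.equivOfCardEq hcard, ?_⟩
    set e := Fintype.equivOfCardEq hcard
    refine (isUnit_det_of_right_inverse (B := N.submatrix e id) ?_).ne_zero
    rw [submatrix_mul_equiv, hMN, submatrix_id_id]

theorem Nonsing.mul_left_iff {P : Matrix α β K} (hP : P.Nonsing) (M : Matrix β γ K) :
    (P * M).Nonsing ↔ M.Nonsing := by
  obtain ⟨Q, hPQ, hQP⟩ := (nonsing_iff_exists_inverse P).mp hP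
  simp only [nonsing_iff_exists_inverse]
  constructor
  · rintro ⟨N, h₁, h₂⟩
    refine ⟨N * P, ?_, by rw [Matrix.mul_assoc, h₂]⟩
    have h : Q * (P * M * N) * P = 1 := by rw [h₁, Matrix.mul_one, hQP]
    calc M * (N * P) = (Q * P) * M * N * P := by rw [hQP, Matrix.one_mul, Matrix.mul_assoc]
      _ = 1 := by rw [← h]; simp only [Matrix.mul_assoc]
  · rintro ⟨N, h₁, h₂⟩
    refine ⟨N * Q, ?_, ?_⟩
    · rw [Matrix.mul_assoc, ← Matrix.mul_assoc M, h₁, Matrix.one_mul, hPQ]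
    · rw [Matrix.mul_assoc, ← Matrix.mul_assoc Q, hQP, Matrix.one_mul, h₂]

theorem Nonsing.submatrix_equiv {M : Matrix α β K} (hM : M.Nonsing) (e : γ ≃ α) (f : δ ≃ β) :
    (M.submatrix e f).Nonsing := by
  obtain ⟨g, hg⟩ := hM
  refine ⟨(e.trans g).trans f.symm, ?_⟩
  rw [← det_submatrix_equiv_self e] at hg
  convert hg using 2
  ext; simp

theorem nonsing_submatrix_equiv_iff (M : Matrix α β K) (e : γ ≃ α) (f : δ ≃ β) :
    (M.submatrix e f).Nonsing ↔ M.Nonsing :=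
  ⟨fun h => by simpa using h.submatrix_equiv e.symm f.symm, fun h => h.submatrix_equiv e f⟩

theorem nonsing_fromBlocks_zero_one_iff (M : Matrix α β K) (N : Matrix γ β K) :
    (fromBlocks M 0 N (1 : Matrix γ γ K)).Nonsing ↔ M.Nonsing := by
  simp only [nonsing_iff_exists_inverse]
  constructor
  · rintro ⟨Q, h₁, h₂⟩
    rw [← fromBlocks_toBlocks Q, fromBlocks_multiply, ← fromBlocks_one, fromBlocks_inj] at h₁ h₂
    refine ⟨Q.toBlocks₁₁, by simpa using h₁.1, ?_⟩
    have h₀ : Q.toBlocks₁₂ = 0 := by simpa using h₂.2.1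
    simpa [h₀] using h₂.1
  · rintro ⟨Q, h₁, h₂⟩
    refine ⟨fromBlocks Q 0 (-(N * Q)) 1, ?_, ?_⟩ <;>
      simp [fromBlocks_multiply, h₁, h₂, Matrix.mul_assoc]

end Matrix

/-- A set `X` gives a nonsingular submatrix of the fundamental cocircuit matrix with respect to
a base `B` iff exchanging along `X` turns `B` into another base. -/
theorem Matrix.IsCocircuitMatrix.nonsing_csub_iff {K U V : Type*} [Field K] [Fintype U]
    [Fintype V] [DecidableEq U] [DecidableEq V] {A : Matrix U V K} {B : Finset V}
    {C : Matrix ↥B ↥(Bᶜ) K} (hC : A.IsCocircuitMatrix B C) (hB : A.IsBase B) (X : Finset V) :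
    Matrix.Nonsing (csub B C X) ↔ A.IsBase (symmDiff B X) := by
  let e : ↥(X ∩ B) ⊕ ↥(B \ X) ≃ ↥B :=
    { toFun := Sum.elim (Finset.incl Finset.inter_subset_right)
        (Finset.incl Finset.sdiff_subset)
      invFun := fun b => if h : (b : V) ∈ X then .inl ⟨b, by simp [h]⟩ else .inr ⟨b, by simp [h]⟩
      left_inv := by
        rintro (⟨x, hx⟩ | ⟨x, hx⟩) <;> simp at hx <;> simp [Finset.incl, hx]
      right_inv := by
        rintro ⟨x, hx⟩
        by_cases h : x ∈ X <;> simp [Finset.incl, h] }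
  let f : ↥(X \ B) ⊕ ↥(B \ X) ≃ ↥(symmDiff B X) :=
    { toFun := Sum.elim
        (Finset.incl (by intro x hx; simp_all [Finset.mem_symmDiff]))
        (Finset.incl (by intro x hx; simp_all [Finset.mem_symmDiff]))
      invFun := fun b => if h : (b : V) ∈ X
        then .inl ⟨b, by have := Finset.mem_symmDiff.mp b.2; simp_all⟩
        else .inr ⟨b, by have := Finset.mem_symmDiff.mp b.2; simp_all⟩
      left_inv := by
        rintro (⟨x, hx⟩ | ⟨x, hx⟩) <;> simp at hx <;> simp [Finset.incl, hx]
      right_inv := by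
        rintro ⟨x, hx⟩
        by_cases h : x ∈ X <;> simp [Finset.incl, h] }
  let P : Matrix U B K := A.submatrix id (fun b : ↥B => (b : V))
  let N : Matrix ↥(B \ X) ↥(X \ B) K := C.submatrix (Finset.incl Finset.sdiff_subset)
    (Finset.incl (by intro x hx; simp_all))
  have hblock : P.submatrix id e * fromBlocks (csub B C X) 0 N 1 =
      (A.submatrix id (fun b : ↥(symmDiff B X) => (b : V))).submatrix id f := by
    ext u j
    have hcol : ∀ v : ↥(Bᶜ), ∑ b : ↥B, A u b * C b v = A u v := fun v => congr_fun₂ hC u v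
    rcases j with ⟨v, hv⟩ | ⟨v, hv⟩
    · refine Eq.trans ?_ (hcol ⟨v, by simp_all⟩)
      rw [← e.sum_comp, mul_apply, Fintype.sum_sum_type, Fintype.sum_sum_type]
      rfl
    · rw [mul_apply, Fintype.sum_sum_type]
      simp only [fromBlocks_apply₁₂, fromBlocks_apply₂₂, zero_apply, mul_zero,
        Finset.sum_const_zero, zero_add, one_apply, mul_ite, mul_one, Finset.sum_ite_eq',
        Finset.mem_univ, if_true]
      rfl
  have hP : (P.submatrix (Equiv.refl U) e).Nonsing :=
    (nonsing_submatrix_equiv_iff P (Equiv.refl U) e).mpr hB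
  rw [← nonsing_fromBlocks_zero_one_iff _ N, ← hP.mul_left_iff, IsBase,
    ← nonsing_submatrix_equiv_iff _ (Equiv.refl U) f]
  exact iff_of_eq (congrArg Nonsing hblock)

/-- **Pivoting preserves nonsingularity of the relevant submatrices.**
Let `B` be a base of the column matroid of a full-row-rank matrix `A` and `S ⊆ V` a
subset such that `B △ S` is also a base, and let `C` and `C'` be the fundamental
cocircuit matrices with respect to `B` and `B △ S`, respectively.  Then for every
`X ⊆ V`, the submatrix `C[X]` is nonsingular if and only if `C'[X △ S]` is
nonsingular. -/
theorem csub_nonsing_iff_csub_symmDiff_nonsing {K U V : Type*} [Field K] [Fintype U]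
    [Fintype V] [DecidableEq U] [DecidableEq V]
    (A : Matrix U V K) (hrank : A.rank = Fintype.card U)
    (B : Finset V) (hB : A.IsBase B)
    (C : Matrix ↥B ↥(Bᶜ) K) (hC : A.IsCocircuitMatrix B C)
    (S : Finset V) (hBS : A.IsBase (symmDiff B S))
    (C' : Matrix ↥(symmDiff B S) ↥((symmDiff B S)ᶜ) K)
    (hC' : A.IsCocircuitMatrix (symmDiff B S) C')
    (X : Finset V) :
    Matrix.Nonsing (csub B C X) ↔
      Matrix.Nonsing (csub (symmDiff B S) C' (symmDiff X S)) := by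
  rw [hC.nonsing_csub_iff hB, hC'.nonsing_csub_iff hBS, symmDiff_symmDiff_symmDiff_comm,
    symmDiff_self, symmDiff_bot]
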